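/- The atomicity/controlled-invocation finite state machine of VRASED satisfies the atomicity LTL Specification (4): for any input trace satisfying Axiom A4 and with 0 < CR_min < CR_max, the run of the five-state FSM (defined in the context) satisfies G: { irq ∧ (PC ∈ CR) → reset }, i.e., any interrupt raised while the program counter is inside the attestation code region triggers the reset output. -/

import Mathlib

/-- States of the atomicity/controlled-invocation FSM of VRASED. -/
inductive S5 where
  | notCR : S5
  | fstCR : S5
  | midCR : S5
  | lstCR : S5
  | Reset : S5
deriving DecidableEq

-- Transition function of the atomicity/controlled-invocation FSM, on inputs (PC, irq).
open Classical in
noncomputable def atomDelta (CRmin CRmax : ℕ) (PC : ℕ → ℕ) (irq : ℕ → Prop) :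
    S5 → ℕ → S5
  | S5.notCR, t =>
      if PC t < CRmin ∨ PC t > CRmax then S5.notCR
      else if PC t = CRmin ∧ ¬ irq t then S5.fstCR
      else S5.Reset
  | S5.fstCR, t =>
      if PC t = CRmin ∧ ¬ irq t then S5.fstCR
      else if (CRmin < PC t ∧ PC t < CRmax) ∧ ¬ irq t then S5.midCR
      else S5.Reset
  | S5.midCR, t =>
      if (CRmin < PC t ∧ PC t < CRmax) ∧ ¬ irq t then S5.midCR
      else if PC t = CRmax ∧ ¬ irq t then S5.lstCR
      else S5.Reset
  | S5.lstCR, t =>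
      if PC t = CRmax ∧ ¬ irq t then S5.lstCR
      else if (PC t < CRmin ∨ PC t > CRmax) ∧ ¬ irq t then S5.notCR
      else S5.Reset
  | S5.Reset, t =>
      if PC t = 0 then S5.notCR
      else S5.Reset


theorem atomDelta_eq_reset_of_irq {CRmin CRmax : ℕ} (hmin : 0 < CRmin) {PC : ℕ → ℕ}
    {irq : ℕ → Prop} {t : ℕ} (hirq : irq t) (hl : CRmin ≤ PC t) (hu : PC t ≤ CRmax) (q : S5) :
    atomDelta CRmin CRmax PC irq q t = S5.Reset := by
  have hout : ¬ (PC t < CRmin ∨ PC t > CRmax) := by omega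
  have hne : PC t ≠ 0 := by omega
  cases q <;> simp only [atomDelta, hirq, hout, hne, not_true_eq_false, and_false, if_false]

/-- the atomicity/controlled-invocation FSM of VRASED satisfies the
atomicity LTL Specification (4): for any input trace satisfying Axiom A4 and with
0 < CR_min < CR_max, at every time, irq ∧ (PC ∈ CR) → reset, where
reset(t) := (s(t) = Reset). -/
theorem atomicity_fsm_satisfies_spec4
    (CRmin CRmax : ℕ)
    (hCR : 0 < CRmin ∧ CRmin < CRmax)
    (PC Daddr DMAaddr : ℕ → ℕ)
    (irq Ren Wen DMAen : ℕ → Prop)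
    (s : ℕ → S5)
    (hs0 : s 0 = S5.Reset)
    (hstep : ∀ t : ℕ, s (t + 1) = atomDelta CRmin CRmax PC irq (s t) (t + 1))
    (hA4 : ∀ t : ℕ, PC t = 0 → ¬Ren t ∧ ¬Wen t ∧ ¬DMAen t ∧ ¬irq t) :
    ∀ t : ℕ, (irq t ∧ (CRmin ≤ PC t ∧ PC t ≤ CRmax)) → s t = S5.Reset := by
  rintro (_ | t) ⟨hirq, hl, hu⟩
  · exact hs0
  · rw [hstep t]
    exact atomDelta_eq_reset_of_irq hCR.1 hirq hl hu (s t)
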